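/- arXiv:1407.5607 — 9 statements merged into one kernel-verified Lean document; each statement's English description precedes it below -/
import Mathlib

section
/- Let G be a finite connected vertex-transitive simple graph with n vertices and diameter D (the maximum of the graph distance over all pairs of vertices). Let A = (1/n²) Σ_{x,y ∈ V} d(x,y) be the average graph distance over all ordered pairs of vertices. Then D/2 ≤ A. -/
namespace SimpleGraph

variable {V W : Type*} {G : SimpleGraph V} {H : SimpleGraph W}

theorem Connected.dist_map_le (hG : G.Connected) (f : G →g H) (x y : V) :
    H.dist (f x) (f y) ≤ G.dist x y := by
  obtain ⟨p, hp⟩ := hG.exists_walk_length_eq_dist x y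
  rw [← hp, ← Walk.length_map f p]
  exact dist_le _

theorem Connected.dist_iso_apply (hG : G.Connected) (g : G ≃g G) (x y : V) :
    G.dist (g x) (g y) = G.dist x y := by
  apply le_antisymm (hG.dist_map_le g.toHom x y)
  simpa using hG.dist_map_le g.symm.toHom (g x) (g y)

theorem Connected.sum_dist_iso_apply [Fintype V] (hG : G.Connected) (g : G ≃g G) (x : V) :
    ∑ y, (G.dist (g x) y : ℝ) = ∑ y, (G.dist x y : ℝ) := by
  rw [← Equiv.sum_comp g.toEquiv]
  exact Finset.sum_congr rfl fun y _ ↦ congrArg _ (hG.dist_iso_apply g x y)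

end SimpleGraph

/-- In a finite connected vertex-transitive simple graph with `n` vertices and
diameter `D`, the average distance `A = (1/n²) Σ_{x,y} d(x,y)` satisfies `D/2 ≤ A`. -/
theorem stmt_0 {V : Type*} [Fintype V] [Nonempty V] (G : SimpleGraph V)
    (hconn : G.Connected)
    (htrans : ∀ x y : V, ∃ g : G ≃g G, g x = y)
    (n : ℕ) (hn : n = Fintype.card V)
    (D : ℕ) (hDub : ∀ x y : V, G.dist x y ≤ D)
    (hDmax : ∃ x y : V, G.dist x y = D)
    (A : ℝ) (hA : A = (1 / (n : ℝ) ^ 2) * ∑ x : V, ∑ y : V, (G.dist x y : ℝ)) :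
    (D : ℝ) / 2 ≤ A := by
  obtain ⟨u, v, huv⟩ := hDmax
  have hsum : ∀ x, ∑ y, (G.dist x y : ℝ) = ∑ y, (G.dist u y : ℝ) := fun x ↦ by
    obtain ⟨g, rfl⟩ := htrans u x
    exact hconn.sum_dist_iso_apply g u
  have hnpos : (0 : ℝ) < n := by
    rw [hn]
    exact_mod_cast Fintype.card_pos
  have htri : (n : ℝ) * D ≤ 2 * ∑ y, (G.dist u y : ℝ) := by
    calc (n : ℝ) * D = ∑ _z : V, (D : ℝ) := by simp [hn]
      _ ≤ ∑ z, ((G.dist u z : ℝ) + G.dist v z) := by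
        refine Finset.sum_le_sum fun z _ ↦ ?_
        rw [← huv, G.dist_comm (u := v)]
        exact_mod_cast hconn.dist_triangle
      _ = 2 * ∑ y, (G.dist u y : ℝ) := by
        rw [Finset.sum_add_distrib, hsum v, two_mul]
  have hA' : A = (∑ y, (G.dist u y : ℝ)) / n := by
    rw [hA, Finset.sum_congr rfl fun x _ ↦ hsum x]
    simp only [Finset.sum_const, Finset.card_univ, nsmul_eq_mul, ← hn]
    field_simp
  rw [hA', div_le_div_iff₀ two_pos hnpos]
  linarith
end

section
/- Let G be a finite connected vertex-transitive simple graph with n ≥ 2 vertices and diameter D (the maximum of the graph distance over all pairs of vertices). Let Ā = (1/(n(n−1))) Σ_{x ≠ y} d(x,y) be the average graph distance over ordered pairs of distinct vertices. Then (D/2)·(n/(n−1)) ≤ Ā ≤ D. -/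
theorem SimpleGraph.Hom.dist_le {V W : Type*} {G : SimpleGraph V} {H : SimpleGraph W}
    (f : G →g H) {x y : V} (h : G.Reachable x y) : H.dist (f x) (f y) ≤ G.dist x y := by
  obtain ⟨p, hp⟩ := h.exists_walk_length_eq_dist
  rw [← hp, ← p.length_map f]
  exact SimpleGraph.dist_le _

theorem SimpleGraph.Iso.dist_eq {V W : Type*} {G : SimpleGraph V} {H : SimpleGraph W}
    (g : G ≃g H) (hG : G.Connected) (x y : V) : H.dist (g x) (g y) = G.dist x y := by
  refine le_antisymm (g.toHom.dist_le (hG x y)) ?_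
  simpa using g.symm.toHom.dist_le ((hG x y).map g.toHom)

/-- The sum of the distances from a vertex is preserved by automorphisms. -/
theorem SimpleGraph.Iso.sum_dist_eq {V : Type*} [Fintype V] {G : SimpleGraph V}
    (g : G ≃g G) (hG : G.Connected) (x : V) :
    ∑ y, G.dist (g x) y = ∑ y, G.dist x y := by
  rw [← Equiv.sum_comp g.toEquiv]
  exact Finset.sum_congr rfl fun y _ ↦ g.dist_eq hG x y

theorem SimpleGraph.Connected.card_mul_dist_le {V : Type*} [Fintype V] {G : SimpleGraph V}
    (hG : G.Connected) (x y : V) :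
    Fintype.card V * G.dist x y ≤ ∑ z, G.dist x z + ∑ z, G.dist y z := by
  rw [← Finset.sum_add_distrib, ← smul_eq_mul, ← Finset.card_univ]
  refine Finset.card_nsmul_le_sum _ _ _ fun z _ ↦ ?_
  rw [G.dist_comm (u := y)]
  exact hG.dist_triangle

/-- In a finite connected vertex-transitive simple graph with `n ≥ 2` vertices and
diameter `D`, the average distance over ordered pairs of distinct vertices
`Ā = (1/(n(n-1))) Σ_{x ≠ y} d(x,y)` satisfies `(D/2)·(n/(n-1)) ≤ Ā ≤ D`. -/
theorem stmt_2 {V : Type*} [Fintype V] [DecidableEq V] (G : SimpleGraph V)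
    (hconn : G.Connected)
    (htrans : ∀ x y : V, ∃ g : G ≃g G, g x = y)
    (n : ℕ) (hn : n = Fintype.card V) (hn2 : 2 ≤ n)
    (D : ℕ) (hDub : ∀ x y : V, G.dist x y ≤ D)
    (hDmax : ∃ x y : V, G.dist x y = D)
    (Abar : ℝ)
    (hA : Abar = (1 / ((n : ℝ) * ((n : ℝ) - 1))) *
      ∑ x : V, ∑ y ∈ Finset.univ.filter (fun y => y ≠ x), (G.dist x y : ℝ)) :
    (D : ℝ) / 2 * ((n : ℝ) / ((n : ℝ) - 1)) ≤ Abar ∧ Abar ≤ D := by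
  obtain ⟨a, b, hab⟩ := hDmax
  have hn1 : (0 : ℝ) < n - 1 := by
    have : (2 : ℝ) ≤ n := by exact_mod_cast hn2
    linarith
  have hn0 : (0 : ℝ) < n := by linarith
  have hT (x : V) : ∑ y, G.dist x y = ∑ y, G.dist a y := by
    obtain ⟨g, rfl⟩ := htrans a x
    exact g.sum_dist_eq hconn a
  have hoff (x : V) : ∑ y ∈ Finset.univ.filter (fun y => y ≠ x), (G.dist x y : ℝ) =
      ((∑ y, G.dist a y : ℕ) : ℝ) := by
    rw [← hT x, Nat.cast_sum]
    refine Finset.sum_subset (Finset.filter_subset _ _) fun y _ hy ↦ ?_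
    obtain rfl : y = x := by simpa using hy
    simp
  have hlow : (n : ℝ) * D ≤ 2 * ((∑ y, G.dist a y : ℕ) : ℝ) := by
    have h := hconn.card_mul_dist_le a b
    rw [hT b, hab, ← hn, ← two_mul] at h
    exact_mod_cast h
  have hup : ((∑ y, G.dist a y : ℕ) : ℝ) ≤ (n - 1) * D := by
    rw [← hoff a]
    refine (Finset.sum_le_card_nsmul _ _ (D : ℝ) fun y _ ↦ by exact_mod_cast hDub a y).trans_eq ?_
    rw [Finset.filter_ne', Finset.card_erase_of_mem (Finset.mem_univ a), Finset.card_univ, ← hn,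
      nsmul_eq_mul, Nat.cast_sub (by omega), Nat.cast_one]
  have hAbar : Abar = ((∑ y, G.dist a y : ℕ) : ℝ) / (n - 1) := by
    rw [hA, Finset.sum_congr rfl fun x _ ↦ hoff x, Finset.sum_const, Finset.card_univ, ← hn,
      nsmul_eq_mul]
    field_simp
  rw [hAbar]
  constructor
  · rw [← mul_div_assoc]
    gcongr
    linarith
  · rw [div_le_iff₀ hn1]
    linarith
end

section
/- Let X be a nonempty compact homogeneous metric space with diameter D, and let m be a Borel probability measure on X invariant under all isometric equivalences of X. Let A = ∫_{X×X} d(x,y) d(m×m)(x,y) be the average distance in X. Then D/2 ≤ A. -/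
open MeasureTheory

/-- On a compact space, the distance to a fixed point is integrable for any finite measure. -/
lemma integrable_dist_left {X : Type*} [MetricSpace X] [CompactSpace X]
    [MeasurableSpace X] [BorelSpace X] (m : Measure X) [IsFiniteMeasure m] (x : X) :
    Integrable (fun z => dist x z) m :=
  (by fun_prop : Continuous fun z => dist x z).integrable_of_hasCompactSupport
    (HasCompactSupport.of_compactSpace _)

/-- The mean distance to a point is unchanged by a measure-preserving isometry. -/
lemma integral_dist_isometryEquiv_apply {X : Type*} [MetricSpace X]
    [MeasurableSpace X] [BorelSpace X] (m : Measure X) (g : X ≃ᵢ X)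
    (hg : Measure.map g m = m) (x : X) :
    ∫ z, dist (g x) z ∂m = ∫ z, dist x z ∂m := by
  have h := g.toHomeomorph.measurableEmbedding.integral_map (μ := m) fun z => dist (g x) z
  simpa [hg, g.dist_eq] using h

/-- In a nonempty compact homogeneous metric space of diameter `D` with an
isometry-invariant Borel probability measure `m`, the average distance
`A = ∫_{X×X} d(x,y) d(m×m)` satisfies `D/2 ≤ A`. -/
theorem stmt_4 {X : Type*} [MetricSpace X] [CompactSpace X] [Nonempty X]
    [MeasurableSpace X] [BorelSpace X]
    (hhom : ∀ x y : X, ∃ g : X ≃ᵢ X, g x = y)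
    (m : Measure X) [IsProbabilityMeasure m]
    (hinv : ∀ g : X ≃ᵢ X, Measure.map g m = m)
    (D : ℝ) (hD : D = Metric.diam (Set.univ : Set X))
    (A : ℝ) (hA : A = ∫ p : X × X, dist p.1 p.2 ∂(m.prod m)) :
    D / 2 ≤ A := by
  have hconst : ∀ x y : X, ∫ z, dist x z ∂m = ∫ z, dist y z ∂m := by
    intro x y
    obtain ⟨g, rfl⟩ := hhom x y
    exact (integral_dist_isometryEquiv_apply m g (hinv g) x).symm
  have hint : Integrable (fun p : X × X => dist p.1 p.2) (m.prod m) :=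
    continuous_dist.integrable_of_hasCompactSupport (HasCompactSupport.of_compactSpace _)
  have hmean : ∀ x : X, A = ∫ z, dist x z ∂m := by
    intro x
    rw [hA, integral_prod _ hint]
    simp [fun y => hconst y x]
  have hdist : ∀ x y : X, dist x y ≤ 2 * A := by
    intro x y
    calc dist x y = ∫ _, dist x y ∂m := by simp
      _ ≤ ∫ z, (dist x z + dist y z) ∂m :=
        integral_mono (integrable_const _)
          ((integrable_dist_left m x).add (integrable_dist_left m y))
          fun z => dist_triangle_right x y z
      _ = 2 * A := by
        rw [integral_add (integrable_dist_left m x) (integrable_dist_left m y),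
          ← hmean x, ← hmean y, two_mul]
  obtain ⟨x₀⟩ := ‹Nonempty X›
  have hA_nonneg : 0 ≤ 2 * A := dist_nonneg.trans (hdist x₀ x₀)
  have hdiam : D ≤ 2 * A :=
    hD ▸ Metric.diam_le_of_forall_dist_le hA_nonneg fun x _ y _ => hdist x y
  linarith
end

section
/- Let X be a nonempty compact metric space with diameter D which is antipodal: for every x ∈ X there exists a point O_x with d(x, O_x) = D and a surjective isometry (isometric equivalence) of X taking x to O_x. Let m be a Borel probability measure on X invariant under all isometric equivalences of X. Then for every y ∈ X the average distance to y satisfies ∫_X d(x,y) dm(x) ≥ D/2. -/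
open MeasureTheory

/-- In a nonempty compact antipodal metric space of diameter `D` with an
isometry-invariant Borel probability measure `m`, for every `y` the average
distance to `y` satisfies `∫_X d(x,y) dm(x) ≥ D/2`. -/
theorem stmt_7 {X : Type*} [MetricSpace X] [CompactSpace X] [Nonempty X]
    [MeasurableSpace X] [BorelSpace X]
    (D : ℝ) (hD : D = Metric.diam (Set.univ : Set X))
    (hant : ∀ x : X, ∃ (Ox : X) (g : X ≃ᵢ X), dist x Ox = D ∧ g x = Ox)
    (m : Measure X) [IsProbabilityMeasure m]
    (hinv : ∀ g : X ≃ᵢ X, Measure.map g m = m) :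
    ∀ y : X, D / 2 ≤ ∫ x : X, dist x y ∂m := by
  intro y
  obtain ⟨_, g, hyz, rfl⟩ := hant y
  have hint (z : X) : Integrable (fun x ↦ dist x z) m :=
    (continuous_id.dist continuous_const).integrable_of_hasCompactSupport
      (HasCompactSupport.of_compactSpace _)
  have hg : ∫ x, dist x (g y) ∂m = ∫ x, dist x y ∂m := by
    conv_lhs => rw [← hinv g]
    rw [MeasurableEmbedding.integral_map (f := g) g.toHomeomorph.measurableEmbedding]
    simp [g.dist_eq]
  have hD_le : D ≤ ∫ x, (dist x y + dist x (g y)) ∂m := by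
    calc D = ∫ _ : X, D ∂m := by simp
      _ ≤ _ := integral_mono (integrable_const D) ((hint y).add (hint (g y))) fun x ↦
        hyz ▸ dist_triangle_left y (g y) x
  rw [integral_add (hint y) (hint (g y)), hg] at hD_le
  linarith
end

section
/- Let X be an infinite compact homogeneous metric space with diameter D > 0, and let m be a Borel probability measure on X invariant under all isometric equivalences of X. Then the average distance A = ∫_{X×X} d(x,y) d(m×m)(x,y) satisfies A < D; in particular the upper bound A = D cannot be attained when X is infinite. -/
open MeasureTheory

/-- A nonzero measure invariant under a transitive isometry group of a compact metric space
charges every nonempty open set. -/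
theorem isOpenPosMeasure_of_isometryEquiv_transitive {X : Type*} [MetricSpace X] [CompactSpace X]
    [MeasurableSpace X] [BorelSpace X]
    (hhom : ∀ x y : X, ∃ g : X ≃ᵢ X, g x = y)
    (m : Measure X) [NeZero m] (hinv : ∀ g : X ≃ᵢ X, Measure.map g m = m) :
    m.IsOpenPosMeasure := by
  refine ⟨fun U hU ⟨x, hx⟩ h0 => ?_⟩
  have hnull : m Set.univ = 0 := by
    refine measure_null_of_locally_null _ fun y _ => ?_
    obtain ⟨g, hg⟩ := hhom y x
    refine ⟨g ⁻¹' U, mem_nhdsWithin_of_mem_nhds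
      ((hU.preimage g.continuous).mem_nhds (by simpa [hg] using hx)), ?_⟩
    rw [← Measure.map_apply g.continuous.measurable hU.measurableSet, hinv g, h0]
  exact NeZero.ne m (Measure.measure_univ_eq_zero.mp hnull)

/-- In an infinite compact homogeneous metric space of diameter `D > 0` with an
isometry-invariant Borel probability measure `m`, the average distance
`A = ∫_{X×X} d(x,y) d(m×m)` satisfies `A < D`. -/
theorem stmt_9 {X : Type*} [MetricSpace X] [CompactSpace X] [Infinite X]
    [MeasurableSpace X] [BorelSpace X]
    (hhom : ∀ x y : X, ∃ g : X ≃ᵢ X, g x = y)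
    (m : Measure X) [IsProbabilityMeasure m]
    (hinv : ∀ g : X ≃ᵢ X, Measure.map g m = m)
    (D : ℝ) (hD : D = Metric.diam (Set.univ : Set X)) (hDpos : 0 < D)
    (A : ℝ) (hA : A = ∫ p : X × X, dist p.1 p.2 ∂(m.prod m)) :
    A < D := by
  have := isOpenPosMeasure_of_isometryEquiv_transitive hhom m hinv
  obtain ⟨x⟩ : Nonempty X := inferInstance
  have hdist : Continuous fun p : X × X => dist p.1 p.2 := continuous_dist
  have hgap : Continuous fun p : X × X => D - dist p.1 p.2 := continuous_const.sub hdist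
  have hpos : 0 < ∫ p : X × X, (D - dist p.1 p.2) ∂(m.prod m) := by
    refine hgap.integral_pos_of_hasCompactSupport_nonneg_nonzero
      (HasCompactSupport.of_compactSpace _) (fun p => ?_) (x := (x, x)) (by simpa using hDpos.ne')
    have h := Metric.dist_le_diam_of_mem (isCompact_univ (X := X)).isBounded
      (Set.mem_univ p.1) (Set.mem_univ p.2)
    simpa [hD] using h
  have hint : Integrable (fun p : X × X => dist p.1 p.2) (m.prod m) :=
    hdist.integrable_of_hasCompactSupport (HasCompactSupport.of_compactSpace _)
  rw [integral_sub (integrable_const _) hint, ← hA] at hpos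
  simpa using hpos
end

section
/- Let X be a nonempty compact metric space with diameter D which is strictly antipodal: for every x ∈ X there exists a point O_x with d(x, O_x) = D, a surjective isometry (isometric equivalence) of X taking x to O_x, and d(x,y) + d(y, O_x) = D for all y ∈ X. Let m be a Borel probability measure on X invariant under all isometric equivalences of X. Then the average distance A = ∫_{X×X} d(x,y) d(m×m)(x,y) equals D/2. -/
open MeasureTheory

/-- The mean distance to a point which has an isometric antipode at distance `D` is `D / 2`. -/
theorem integral_dist_eq_half_of_antipode {X : Type*} [MetricSpace X] [CompactSpace X]
    [MeasurableSpace X] [BorelSpace X] (D : ℝ) (m : Measure X) [IsProbabilityMeasure m]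
    (hinv : ∀ g : X ≃ᵢ X, Measure.map g m = m)
    (hstrict : ∀ x : X, ∃ (Ox : X) (g : X ≃ᵢ X), dist x Ox = D ∧ g x = Ox ∧
      ∀ y : X, dist x y + dist y Ox = D) (x : X) :
    ∫ y, dist x y ∂m = D / 2 := by
  obtain ⟨z, g, -, hg, hsum⟩ := hstrict x
  have hint (w : X) : Integrable (fun y => dist w y) m :=
    (continuous_const.dist continuous_id).integrable_of_hasCompactSupport
      (HasCompactSupport.of_compactSpace _)
  have heq : ∫ y, dist z y ∂m = ∫ y, dist x y ∂m := by
    calc ∫ y, dist z y ∂m = ∫ y, dist z y ∂(Measure.map g m) := by rw [hinv g]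
      _ = ∫ y, dist z (g y) ∂m :=
        g.toHomeomorph.measurableEmbedding.integral_map _
      _ = ∫ y, dist x y ∂m := by simp_rw [← hg, g.dist_eq]
  have hadd : ∫ y, dist x y ∂m + ∫ y, dist z y ∂m = D := by
    rw [← integral_add (hint x) (hint z)]
    simp_rw [dist_comm z, hsum]
    simp
  linarith

/-- In a nonempty compact strictly antipodal metric space of diameter `D` with an
isometry-invariant Borel probability measure `m`, the average distance
`A = ∫_{X×X} d(x,y) d(m×m)` equals `D/2`. -/
theorem stmt_12 {X : Type*} [MetricSpace X] [CompactSpace X] [Nonempty X]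
    [MeasurableSpace X] [BorelSpace X]
    (D : ℝ) (hD : D = Metric.diam (Set.univ : Set X))
    (hstrict : ∀ x : X, ∃ (Ox : X) (g : X ≃ᵢ X), dist x Ox = D ∧ g x = Ox ∧
      ∀ y : X, dist x y + dist y Ox = D)
    (m : Measure X) [IsProbabilityMeasure m]
    (hinv : ∀ g : X ≃ᵢ X, Measure.map g m = m)
    (A : ℝ) (hA : A = ∫ p : X × X, dist p.1 p.2 ∂(m.prod m)) :
    A = D / 2 := by
  have hint : Integrable (fun p : X × X => dist p.1 p.2) (m.prod m) :=
    continuous_dist.integrable_of_hasCompactSupport (HasCompactSupport.of_compactSpace _)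
  rw [hA, integral_prod _ hint]
  simp [integral_dist_eq_half_of_antipode D m hinv hstrict]
end

section
/- Let X be a compact metric space with diameter D which is strictly antipodal, and let O : X → X be the map sending each point x to its unique antipode O_x (so d(x, O_x) = D and d(x,y) + d(y, O_x) = D for all y). Then: (i) O is an isometry, i.e. d(O_x, O_y) = d(x,y) for all x, y ∈ X; (ii) O ∘ O is the identity map on X; and (iii) O commutes with every surjective isometry g of X, i.e. g(O_x) = O_{g(x)} for all x ∈ X. -/
/-- In a compact strictly antipodal metric space of diameter `D`, the antipodal
map `O` (sending each point to its unique antipode) is an isometry, is an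
involution, and commutes with every surjective isometry of `X`. -/
theorem stmt_14 {X : Type*} [MetricSpace X] [CompactSpace X]
    (D : ℝ) (hD : D = Metric.diam (Set.univ : Set X))
    (O : X → X)
    (hO : ∀ x : X, dist x (O x) = D ∧ ∀ y : X, dist x y + dist y (O x) = D) :
    (∀ x y : X, dist (O x) (O y) = dist x y) ∧
    (∀ x : X, O (O x) = x) ∧
    (∀ g : X ≃ᵢ X, ∀ x : X, g (O x) = O (g x)) := by
  refine ⟨fun x y => ?_, fun x => ?_, fun g x => ?_⟩
  · have h₁ := (hO x).2 y
    have h₂ := (hO y).2 (O x)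
    linarith
  · have h₁ := (hO x).1
    have h₂ := (hO (O x)).2 x
    rw [dist_comm] at h₁
    exact (dist_eq_zero.mp (by linarith : dist x (O (O x)) = 0)).symm
  · have h₁ := (hO x).1
    have h₂ := (hO (g x)).2 (g (O x))
    rw [g.dist_eq] at h₂
    exact dist_eq_zero.mp (by linarith)
end

section
/- Let X be a compact metric space with diameter D which is strictly antipodal: for every x ∈ X there exists O_x with d(x, O_x) = D, a surjective isometry (isometric equivalence) of X taking x to O_x, and d(x,y) + d(y, O_x) = D for all y ∈ X. Let m be a Borel probability measure on X invariant under all isometric equivalences of X. Then the distribution of distances is symmetric about D/2: for every a with 0 ≤ a ≤ D, (m×m)({(x,y) ∈ X×X : d(x,y) ≤ a}) = (m×m)({(x,y) ∈ X×X : d(x,y) ≥ D − a}). -/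
open MeasureTheory

/-- The measure of a closed ball is unchanged when its centre is moved by an isometric
equivalence preserving the measure. -/
theorem measure_closedBall_isometryEquiv_apply {X : Type*} [PseudoMetricSpace X]
    [MeasurableSpace X] [BorelSpace X] {m : Measure X} {g : X ≃ᵢ X}
    (hg : Measure.map g m = m) (x : X) (a : ℝ) :
    m (Metric.closedBall (g x) a) = m (Metric.closedBall x a) := by
  conv_lhs => rw [← hg]
  rw [Measure.map_apply g.continuous.measurable Metric.isClosed_closedBall.measurableSet,
    g.preimage_closedBall, g.symm_apply_apply]

/-- In a compact strictly antipodal metric space of diameter `D` with an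
isometry-invariant Borel probability measure `m`, the distribution of distances
is symmetric about `D/2`: for every `0 ≤ a ≤ D`,
`(m×m)({(x,y) : d(x,y) ≤ a}) = (m×m)({(x,y) : d(x,y) ≥ D - a})`. -/
theorem stmt_16 {X : Type*} [MetricSpace X] [CompactSpace X]
    [MeasurableSpace X] [BorelSpace X]
    (D : ℝ) (hD : D = Metric.diam (Set.univ : Set X))
    (hstrict : ∀ x : X, ∃ (Ox : X) (g : X ≃ᵢ X), dist x Ox = D ∧ g x = Ox ∧
      ∀ y : X, dist x y + dist y Ox = D)
    (m : Measure X) [IsProbabilityMeasure m]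
    (hinv : ∀ g : X ≃ᵢ X, Measure.map g m = m) :
    ∀ a : ℝ, 0 ≤ a → a ≤ D →
      (m.prod m) {p : X × X | dist p.1 p.2 ≤ a} =
      (m.prod m) {p : X × X | D - a ≤ dist p.1 p.2} := by
  intro a _ _
  rw [Measure.prod_apply (isClosed_le continuous_dist continuous_const).measurableSet,
    Measure.prod_apply (isClosed_le continuous_const continuous_dist).measurableSet]
  refine lintegral_congr fun x => ?_
  obtain ⟨_, g, -, rfl, hx⟩ := hstrict x
  calc m {y | dist x y ≤ a} = m (Metric.closedBall x a) := by
        congr 1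
        ext y
        simp [dist_comm]
    _ = m (Metric.closedBall (g x) a) :=
        (measure_closedBall_isometryEquiv_apply (hinv g) x a).symm
    _ = m {y | D - a ≤ dist x y} := by
        congr 1
        ext y
        rw [Metric.mem_closedBall, Set.mem_ofPred_eq, ← hx y]
        constructor <;> intro h <;> linarith
end

section
/- Let p be a prime and let Z_p denote the ring of p-adic integers with its standard p-adic metric d(x,y) = |x − y|_p, and let μ be the Haar probability measure on the compact additive group Z_p. Then the diameter of Z_p is 1 and the average distance satisfies ∫_{Z_p × Z_p} d(x,y) d(μ×μ)(x,y) = p/(p+1). -/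
open MeasureTheory

namespace PadicInt

variable {p : ℕ} [Fact p.Prime]

theorem diam_univ : Metric.diam (Set.univ : Set ℤ_[p]) = 1 := by
  apply le_antisymm
  · refine Metric.diam_le_of_forall_dist_le zero_le_one fun x _ y _ ↦ ?_
    rw [dist_eq_norm]
    exact norm_le_one _
  · simpa using Metric.dist_le_diam_of_mem isCompact_univ.isBounded
      (Set.mem_univ (1 : ℤ_[p])) (Set.mem_univ 0)

lemma range_mulLeft_natCast_prime :
    Set.range (AddMonoidHom.mulLeft (p : ℤ_[p])) = Metric.ball 0 1 := by
  ext x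
  simp only [Set.mem_range, AddMonoidHom.coe_mulLeft, mem_ball_zero_iff, norm_lt_one_iff_dvd,
    dvd_def, eq_comm]

lemma isOpenEmbedding_mulLeft_natCast_prime :
    Topology.IsOpenEmbedding (AddMonoidHom.mulLeft (p : ℤ_[p])) := by
  have hp : (p : ℤ_[p]) ≠ 0 := Nat.cast_ne_zero.2 (Fact.out : p.Prime).ne_zero
  have hc : Continuous (AddMonoidHom.mulLeft (p : ℤ_[p])) := continuous_const_mul (p : ℤ_[p])
  refine ⟨(hc.isClosedEmbedding (mul_right_injective₀ hp)).isEmbedding, ?_⟩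
  rw [range_mulLeft_natCast_prime]
  exact Metric.isOpen_ball

variable [MeasurableSpace ℤ_[p]] [BorelSpace ℤ_[p]]
  (μ : Measure ℤ_[p]) [IsProbabilityMeasure μ] [μ.IsAddHaarMeasure]

lemma measure_ball_zero_one : μ (Metric.ball 0 1) = (p : ENNReal)⁻¹ := by
  let H : AddSubgroup ℤ_[p] := (toZMod (p := p)).toAddMonoidHom.ker
  have hH : (H : Set ℤ_[p]) = Metric.ball 0 1 := by
    ext x
    change toZMod x = 0 ↔ _
    rw [← RingHom.mem_ker, ker_toZMod, mem_ball_zero_iff, IsLocalRing.mem_maximalIdeal,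
      mem_nonunits]
  have hindex : H.index = p := by
    rw [AddSubgroup.index_ker, AddMonoidHom.range_eq_top.2 (ZMod.ringHom_surjective toZMod)]
    simp
  have : H.FiniteIndex := ⟨by rw [hindex]; exact (Fact.out : p.Prime).ne_zero⟩
  have h := H.index_mul_measure (hH ▸ measurableSet_ball) μ
  rw [hindex, hH, measure_univ, mul_comm] at h
  exact ENNReal.eq_inv_of_mul_eq_one_left h

lemma comap_mulLeft_natCast_prime :
    μ.comap (AddMonoidHom.mulLeft (p : ℤ_[p])) = (p : ENNReal)⁻¹ • μ := by
  have hf := isOpenEmbedding_mulLeft_natCast_prime (p := p)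
  have := Measure.IsAddHaarMeasure.comap (mH := inferInstance) μ hf
  have h := Measure.isAddInvariant_eq_smul_of_compactSpace
    (μ.comap (AddMonoidHom.mulLeft (p : ℤ_[p]))) μ
  have huniv := congrArg (fun ν : Measure ℤ_[p] ↦ ν Set.univ) h
  simp only [hf.measurableEmbedding.comap_apply, Set.image_univ, range_mulLeft_natCast_prime,
    measure_ball_zero_one, Measure.smul_apply, measure_univ, ENNReal.smul_def, smul_eq_mul,
    mul_one] at huniv
  rw [h, huniv]
  rfl

lemma setIntegral_norm_ball_zero_one :
    ∫ x in Metric.ball (0 : ℤ_[p]) 1, ‖x‖ ∂μ = (p : ℝ)⁻¹ ^ 2 * ∫ x, ‖x‖ ∂μ := by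
  have hf := (isOpenEmbedding_mulLeft_natCast_prime (p := p)).measurableEmbedding
  rw [← range_mulLeft_natCast_prime, ← hf.map_comap, hf.integral_map,
    comap_mulLeft_natCast_prime, integral_smul_measure]
  simp only [AddMonoidHom.coe_mulLeft, norm_mul, norm_p, integral_const_mul, ENNReal.toReal_inv,
    ENNReal.toReal_natCast, smul_eq_mul]
  ring

lemma setIntegral_norm_compl_ball_zero_one :
    ∫ x in (Metric.ball (0 : ℤ_[p]) 1)ᶜ, ‖x‖ ∂μ = 1 - (p : ℝ)⁻¹ := by
  have h : Set.EqOn (fun x : ℤ_[p] ↦ ‖x‖) (fun _ ↦ 1) (Metric.ball (0 : ℤ_[p]) 1)ᶜ := by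
    intro x hx
    exact le_antisymm (norm_le_one x) (by simpa using hx)
  rw [setIntegral_congr_fun measurableSet_ball.compl h, setIntegral_const,
    probReal_compl_eq_one_sub measurableSet_ball, measureReal_def, measure_ball_zero_one]
  simp

theorem integral_norm : ∫ x, ‖x‖ ∂μ = (p : ℝ) / (p + 1) := by
  have hint : Integrable (fun x : ℤ_[p] ↦ ‖x‖) μ :=
    continuous_norm.integrable_of_hasCompactSupport (HasCompactSupport.of_compactSpace _)
  have h := integral_add_compl (measurableSet_ball (x := (0 : ℤ_[p])) (ε := 1)) hint
  rw [setIntegral_norm_ball_zero_one, setIntegral_norm_compl_ball_zero_one] at h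
  have hp : (1 : ℝ) < p := mod_cast (Fact.out : p.Prime).one_lt
  field_simp at h ⊢
  have hp' : (p : ℝ) - 1 ≠ 0 := by linarith
  apply mul_left_cancel₀ hp'
  linarith

end PadicInt

/-- For the `p`-adic integers `ℤ_[p]` with the standard `p`-adic metric and Haar
probability measure `μ`, the diameter is `1` and the average distance is
`p/(p+1)`. -/
theorem stmt_17 (p : ℕ) [Fact p.Prime]
    [MeasurableSpace ℤ_[p]] [BorelSpace ℤ_[p]]
    (μ : Measure ℤ_[p]) [IsProbabilityMeasure μ] [μ.IsAddHaarMeasure] :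
    Metric.diam (Set.univ : Set ℤ_[p]) = 1 ∧
    ∫ q : ℤ_[p] × ℤ_[p], dist q.1 q.2 ∂(μ.prod μ) = p / (p + 1) := by
  refine ⟨PadicInt.diam_univ, ?_⟩
  have hint : Integrable (fun q : ℤ_[p] × ℤ_[p] ↦ dist q.1 q.2) (μ.prod μ) :=
    continuous_dist.integrable_of_hasCompactSupport (HasCompactSupport.of_compactSpace _)
  rw [integral_prod _ hint]
  have h (x : ℤ_[p]) : ∫ y, dist x y ∂μ = p / (p + 1) := by
    simp_rw [dist_comm x, dist_eq_norm]
    rw [integral_sub_right_eq_self (fun y : ℤ_[p] ↦ ‖y‖), PadicInt.integral_norm]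
  simp [h]
end
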